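/- arXiv:1707.04522 — 7 statements merged into one kernel-verified Lean document; each statement's English description precedes it below -/
import Mathlib

section
/- Let G be an additive abelian group, let I be a nonempty index set, let h be a positive integer, and let α : I → G be an injective function with image A = {α(i) : i ∈ I}. Then A is an h-Sidon set if and only if for every function w : I → ℤ with finite nonempty support, with ∑_{i ∈ I} w(i) = 0 and 1 ≤ ∑_{i : w(i) > 0} w(i) ≤ h, one has ∑_{i ∈ I} w(i)·α(i) ≠ 0 in G. -/
/-- A subset `A` of an additive abelian group is an `h`-Sidon set if whenever two
multisets of cardinality `h` with elements in `A` have equal sums, they are equal. -/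
def IsSidonSet {G : Type*} [AddCommGroup G] (h : ℕ) (A : Set G) : Prop :=
  ∀ s t : Multiset G, (∀ x ∈ s, x ∈ A) → (∀ x ∈ t, x ∈ A) →
    Multiset.card s = h → Multiset.card t = h → s.sum = t.sum → s = t

/-- The integer-valued multiplicity function of a multiset, as a sum of indicators. -/
noncomputable def multisetCoeff {I : Type*} (S : Multiset I) : I →₀ ℤ :=
  (S.map fun i => Finsupp.single i (1 : ℤ)).sum

theorem multisetCoeff_apply {I : Type*} [DecidableEq I] (S : Multiset I) (i : I) :
    multisetCoeff S i = S.count i := by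
  induction S using Multiset.induction_on with
  | empty => simp [multisetCoeff]
  | cons a S ih =>
    have h : multisetCoeff (a ::ₘ S) = Finsupp.single a 1 + multisetCoeff S := by
      simp [multisetCoeff]
    rw [h, Finsupp.add_apply, ih, Multiset.count_cons, Finsupp.single_apply]
    by_cases hi : i = a
    · simp [hi, add_comm]
    · simp [hi, Ne.symm hi]

theorem linearCombination_multisetCoeff {I M : Type*} [AddCommGroup M] (f : I → M)
    (S : Multiset I) :
    Finsupp.linearCombination ℤ f (multisetCoeff S) = (S.map f).sum := by
  simp [multisetCoeff, map_multiset_sum, Multiset.map_map]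

/-- The multiset in which `i` has multiplicity the positive part of `w i`. -/
noncomputable def posMultiset {I : Type*} (w : I →₀ ℤ) : Multiset I :=
  Finsupp.toMultiset (w.mapRange Int.toNat rfl)

theorem count_posMultiset {I : Type*} [DecidableEq I] (w : I →₀ ℤ) (i : I) :
    (posMultiset w).count i = (w i).toNat := by
  simp [posMultiset, Finsupp.count_toMultiset]

theorem card_posMultiset {I : Type*} (w : I →₀ ℤ) :
    ((Multiset.card (posMultiset w) : ℕ) : ℤ) =
      ∑ i ∈ w.support.filter (fun i => 0 < w i), w i := by
  rw [posMultiset, Finsupp.card_toMultiset, Finsupp.sum_mapRange_index (by simp), Finsupp.sum,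
    Finset.sum_filter, Nat.cast_sum]
  refine Finset.sum_congr rfl fun i _ => ?_
  simp only [id]
  split_ifs <;> omega

theorem multisetCoeff_posMultiset_sub {I : Type*} (w : I →₀ ℤ) :
    multisetCoeff (posMultiset w) - multisetCoeff (posMultiset (-w)) = w := by
  classical
  ext i
  rw [Finsupp.sub_apply, multisetCoeff_apply, multisetCoeff_apply, count_posMultiset,
    count_posMultiset, Finsupp.neg_apply]
  omega

theorem linearCombination_eq_posMultiset {I M : Type*} [AddCommGroup M] (f : I → M)
    (w : I →₀ ℤ) :
    Finsupp.linearCombination ℤ f w =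
      ((posMultiset w).map f).sum - ((posMultiset (-w)).map f).sum := by
  conv_lhs => rw [← multisetCoeff_posMultiset_sub w]
  rw [map_sub, linearCombination_multisetCoeff, linearCombination_multisetCoeff]

theorem finsupp_sum_eq_linearCombination_one {I : Type*} (w : I →₀ ℤ) :
    (w.sum fun _ n => n) = Finsupp.linearCombination ℤ (fun _ : I => (1 : ℤ)) w := by
  simp [Finsupp.linearCombination_apply]

theorem exists_map_eq_of_forall_mem_range {I G : Type*} {α : I → G} {s : Multiset G}
    (hs : ∀ x ∈ s, x ∈ Set.range α) : ∃ S : Multiset I, S.map α = s :=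
  haveI : CanLift G I α (· ∈ Set.range α) := ⟨fun _ hx => hx⟩
  (Multiset.canLift α (· ∈ Set.range α)).prf s hs

theorem sidon_iff_not_on_hyperplane {G : Type*} [AddCommGroup G] {I : Type*} [Nonempty I]
    (h : ℕ) (hh : 0 < h) (α : I → G) (hα : Function.Injective α) :
    IsSidonSet h (Set.range α) ↔
      ∀ w : I →₀ ℤ, w ≠ 0 →
        (w.sum fun _ n => n) = 0 →
        1 ≤ ∑ i ∈ w.support.filter (fun i => 0 < w i), w i →
        (∑ i ∈ w.support.filter (fun i => 0 < w i), w i) ≤ (h : ℤ) →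
        (w.sum fun i n => n • α i) ≠ 0 := by
  classical
  constructor
  · intro hA w hw hsum _ hle hzero
    rw [← Finsupp.linearCombination_apply, linearCombination_eq_posMultiset, sub_eq_zero] at hzero
    rw [finsupp_sum_eq_linearCombination_one, linearCombination_eq_posMultiset] at hsum
    rw [← card_posMultiset] at hle
    simp only [Multiset.map_const', Multiset.sum_replicate, nsmul_eq_mul, mul_one] at hsum
    obtain ⟨i₀⟩ := ‹Nonempty I›
    set k := h - Multiset.card (posMultiset w) with hk
    have heq := hA ((posMultiset w + Multiset.replicate k i₀).map α)
      ((posMultiset (-w) + Multiset.replicate k i₀).map α)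
      (by intro x hx; obtain ⟨i, -, rfl⟩ := Multiset.mem_map.1 hx; exact ⟨i, rfl⟩)
      (by intro x hx; obtain ⟨i, -, rfl⟩ := Multiset.mem_map.1 hx; exact ⟨i, rfl⟩)
      (by rw [Multiset.card_map, Multiset.card_add, Multiset.card_replicate]; omega)
      (by rw [Multiset.card_map, Multiset.card_add, Multiset.card_replicate]; omega)
      (by rw [Multiset.map_add, Multiset.map_add, Multiset.sum_add, Multiset.sum_add, hzero])
    have hpn := add_right_cancel (Multiset.map_injective hα heq)
    apply hw
    rw [← multisetCoeff_posMultiset_sub w, hpn, sub_self]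
  · intro H s t hs ht hsc htc hst
    obtain ⟨S, rfl⟩ := exists_map_eq_of_forall_mem_range hs
    obtain ⟨T, rfl⟩ := exists_map_eq_of_forall_mem_range ht
    rw [Multiset.card_map] at hsc htc
    set w := multisetCoeff S - multisetCoeff T with hw
    have hwi : ∀ i, w i = S.count i - T.count i := fun i => by
      rw [hw, Finsupp.sub_apply, multisetCoeff_apply, multisetCoeff_apply]
    by_cases hw0 : w = 0
    · congr 1
      ext i
      have := hwi i
      rw [hw0, Finsupp.zero_apply] at this
      omega
    have hsum : (w.sum fun _ n => n) = 0 := by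
      rw [finsupp_sum_eq_linearCombination_one, hw, map_sub, linearCombination_multisetCoeff,
        linearCombination_multisetCoeff]
      simp [hsc, htc]
    have hcard : Multiset.card (posMultiset w) ≤ h := by
      rw [← hsc]
      refine Multiset.card_le_card (Multiset.le_iff_count.2 fun i => ?_)
      rw [count_posMultiset, hwi]
      omega
    have hpos : 1 ≤ Multiset.card (posMultiset w) := by
      by_contra! hlt
      have hc := hsum
      rw [finsupp_sum_eq_linearCombination_one, linearCombination_eq_posMultiset] at hc
      simp only [Multiset.map_const', Multiset.sum_replicate, nsmul_eq_mul, mul_one] at hc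
      have h₁ : posMultiset w = 0 := Multiset.card_eq_zero.1 (by omega)
      have h₂ : posMultiset (-w) = 0 := Multiset.card_eq_zero.1 (by omega)
      apply hw0
      rw [← multisetCoeff_posMultiset_sub w, h₁, h₂, sub_self]
    refine absurd ?_ (H w hw0 hsum (by rw [← card_posMultiset]; omega)
      (by rw [← card_posMultiset]; omega))
    rw [← Finsupp.linearCombination_apply, hw, map_sub, linearCombination_multisetCoeff,
      linearCombination_multisetCoeff, hst, sub_self]
end

section
/- Let G be an additive abelian group, let I be a nonempty index set, let h be a positive integer, and let α : I → G be an injective function. If there exists a function w : I → ℤ with finite nonempty support, with ∑_{i ∈ I} w(i) = 0, with 1 ≤ ∑_{i : w(i) > 0} w(i) ≤ h, and with ∑_{i ∈ I} w(i)·α(i) = 0 in G, then the set A = {α(i) : i ∈ I} is not an h-Sidon set. -/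
theorem not_sidon_of_on_hyperplane {G : Type*} [AddCommGroup G] {I : Type*} [Nonempty I]
    (h : ℕ) (hh : 0 < h) (α : I → G) (hα : Function.Injective α)
    (w : I →₀ ℤ) (hw0 : w ≠ 0)
    (hsum : (w.sum fun _ n => n) = 0)
    (hpos1 : 1 ≤ ∑ i ∈ w.support.filter (fun i => 0 < w i), w i)
    (hposh : (∑ i ∈ w.support.filter (fun i => 0 < w i), w i) ≤ (h : ℤ))
    (hker : (w.sum fun i n => n • α i) = 0) :
    ¬ IsSidonSet h (Set.range α) := by
  classical
  intro hSidon
  obtain ⟨i₀⟩ := ‹Nonempty I›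
  set P : Multiset I := ∑ i ∈ w.support, Multiset.replicate (w i).toNat i with hP
  set N : Multiset I := ∑ i ∈ w.support, Multiset.replicate (-w i).toNat i with hN
  have toNat_sub_toNat_neg : ∀ n : ℤ, ((n.toNat : ℤ) - ((-n).toNat : ℤ)) = n := by
    intro n; omega
  have card_P : (P.card : ℤ) = ∑ i ∈ w.support.filter (fun i => 0 < w i), w i := by
    rw [hP, Multiset.card_sum, Finset.sum_filter]
    push_cast
    refine Finset.sum_congr rfl fun i _ => ?_
    rw [Multiset.card_replicate]
    split_ifs <;> omega
  have card_eq : P.card = N.card := by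
    have hdiff : (P.card : ℤ) - N.card = 0 := by
      rw [← hsum, Finsupp.sum, hP, hN, Multiset.card_sum, Multiset.card_sum]
      push_cast
      rw [← Finset.sum_sub_distrib]
      refine Finset.sum_congr rfl fun i _ => ?_
      rw [Multiset.card_replicate, Multiset.card_replicate, toNat_sub_toNat_neg]
    omega
  have sum_map (n : I → ℕ) : ((∑ i ∈ w.support, Multiset.replicate (n i) i).map α).sum =
      ∑ i ∈ w.support, n i • α i := by
    rw [← Multiset.coe_mapAddMonoidHom, ← Multiset.coe_sumAddMonoidHom, map_sum, map_sum]
    simp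
  have sum_eq : (P.map α).sum = (N.map α).sum := by
    rw [← sub_eq_zero, ← hker, Finsupp.sum, hP, hN, sum_map, sum_map, ← Finset.sum_sub_distrib]
    refine Finset.sum_congr rfl fun i _ => ?_
    rw [← natCast_zsmul, ← natCast_zsmul, ← sub_smul, toNat_sub_toNat_neg]
  have P_ne_N : P ≠ N := by
    intro hPN
    obtain ⟨j, hj⟩ := Finsupp.ne_iff.mp hw0
    have hcount := congrArg (Multiset.count j) hPN
    have hj' : w j ≠ 0 := hj
    simp only [hP, hN, Multiset.count_sum', Multiset.count_replicate, Finset.sum_ite_eq',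
      Finsupp.mem_support_iff, ne_eq, hj', not_false_eq_true, if_true] at hcount
    omega
  set E : Multiset I := Multiset.replicate (h - P.card) i₀ with hE
  have card_P_le : P.card ≤ h := by omega
  have heq := hSidon ((P + E).map α) ((N + E).map α)
    (fun x hx => by obtain ⟨i, -, rfl⟩ := Multiset.mem_map.mp hx; exact ⟨i, rfl⟩)
    (fun x hx => by obtain ⟨i, -, rfl⟩ := Multiset.mem_map.mp hx; exact ⟨i, rfl⟩)
    (by rw [Multiset.card_map, Multiset.card_add, hE, Multiset.card_replicate]; omega)
    (by rw [Multiset.card_map, Multiset.card_add, hE, Multiset.card_replicate]; omega)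
    (by rw [Multiset.map_add, Multiset.map_add, Multiset.sum_add, Multiset.sum_add, sum_eq])
  exact P_ne_N (add_right_cancel (Multiset.map_injective hα heq))
end

section
/- Let F be a field of characteristic zero equipped with a nontrivial absolute value |·| (an absolute value is nontrivial if there exists x ≠ 0 with |x| ≠ 1). Let h be a positive integer, let A be a finite subset of F, let a* ∈ F with a* ∉ A, and let δ > 0. Then there exists b ∈ F such that |b − a*| < δ and the h+1 sets rA + (h−r)·b, for r ∈ {0, 1, …, h}, are pairwise disjoint. -/
/-- The `r`-fold sumset of `A`: sums of multisets of cardinality `r` with elements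
in `A`; for `r = 0` this is `{0}`. -/
def foldSumset {G : Type*} [AddCommMonoid G] (r : ℕ) (A : Set G) : Set G :=
  {x | ∃ s : Multiset G, Multiset.card s = r ∧ (∀ a ∈ s, a ∈ A) ∧ s.sum = x}

/-- The `r`-fold sumset of a finite set is finite. -/
theorem foldSumset_finite {G : Type*} [AddCommMonoid G] (r : ℕ) (A : Finset G) :
    (foldSumset r (A : Set G)).Finite := by
  classical
  refine ((Set.finite_Iic (r • A.val)).image Multiset.sum).subset ?_
  rintro x ⟨s, hs, hsA, rfl⟩
  refine ⟨s, ?_, rfl⟩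
  rw [Set.mem_Iic, Multiset.le_iff_count]
  intro a
  by_cases has : a ∈ s
  · have hA : 1 ≤ A.val.count a := Multiset.one_le_count_iff_mem.2 (hsA a has)
    calc s.count a ≤ r := hs ▸ Multiset.count_le_card a s
      _ ≤ r * A.val.count a := Nat.le_mul_of_pos_right r hA
      _ = (r • A.val).count a := (Multiset.count_nsmul a r A.val).symm
  · simp [Multiset.count_eq_zero_of_notMem has]

/-- Open balls of positive radius for a nontrivial absolute value are infinite. -/
theorem AbsoluteValue.IsNontrivial.infinite_ball {F : Type*} [Field F] {v : AbsoluteValue F ℝ}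
    (hv : v.IsNontrivial) (a : F) {δ : ℝ} (hδ : 0 < δ) : {b : F | v (b - a) < δ}.Infinite := by
  obtain ⟨c, hc0, hc1⟩ := hv.exists_abv_lt_one
  have hpos : 0 < v c := v.pos hc0
  obtain ⟨N, hN⟩ := exists_pow_lt_of_lt_one hδ hc1
  refine Set.infinite_of_injective_forall_mem (f := fun n : ℕ => a + c ^ (N + n)) ?_ ?_
  · intro m n hmn
    have hpow : v c ^ (N + m) = v c ^ (N + n) := by
      simpa only [map_pow] using congrArg v (add_left_cancel hmn)
    exact Nat.add_left_cancel (pow_right_injective₀ hpos hc1.ne hpow)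
  · intro n
    rw [Set.mem_ofPred_eq, add_sub_cancel_left, map_pow]
    exact (pow_le_pow_of_le_one hpos.le hc1.le (Nat.le_add_right N n)).trans_lt hN

theorem exists_perturbation_with_disjoint_translates
    {F : Type*} [Field F] [CharZero F] (v : AbsoluteValue F ℝ)
    (hv : ∃ x : F, x ≠ 0 ∧ v x ≠ 1)
    (h : ℕ) (hh : 0 < h) (A : Finset F) (astar : F) (ha : astar ∉ A)
    (δ : ℝ) (hδ : 0 < δ) :
    ∃ b : F, v (b - astar) < δ ∧
      ∀ r s : ℕ, r ≤ h → s ≤ h → r ≠ s →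
        Disjoint ((fun x => x + (h - r) • b) '' foldSumset r (A : Set F))
                 ((fun x => x + (h - s) • b) '' foldSumset s (A : Set F)) := by
  have hv' : v.IsNontrivial := hv
  let bad : Set F := ⋃ r ∈ Set.Iic h, ⋃ s ∈ Set.Iic h,
    Set.image2 (fun x y => (y - x) / ((s : F) - r))
      (foldSumset r (A : Set F)) (foldSumset s (A : Set F))
  have hbad : bad.Finite :=
    (Set.finite_Iic h).biUnion fun r _ => (Set.finite_Iic h).biUnion fun s _ =>
      (foldSumset_finite r A).image2 _ (foldSumset_finite s A)
  obtain ⟨b, hb, hb_bad⟩ := (hv'.infinite_ball astar hδ).exists_notMem_finite hbad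
  refine ⟨b, hb, fun r s hr hs hrs => Set.disjoint_left.2 ?_⟩
  rintro _ ⟨x, hx, rfl⟩ ⟨y, hy, hxy⟩
  apply hb_bad
  refine Set.mem_biUnion hr (Set.mem_biUnion hs ⟨x, hx, y, hy, ?_⟩)
  have hsr : (s : F) - r ≠ 0 := sub_ne_zero.2 (Nat.cast_injective.ne hrs.symm)
  simp only [nsmul_eq_mul, Nat.cast_sub hr, Nat.cast_sub hs] at hxy
  rw [div_eq_iff hsr]
  linear_combination hxy
end

section
/- Let F be a field of characteristic zero equipped with a nontrivial absolute value |·| (an absolute value is nontrivial if there exists x ≠ 0 with |x| ≠ 1). Let h be a positive integer, let α : ℕ → F be an injective function, and let (ε_i)_{i ∈ ℕ} be a sequence of real numbers with ε_i > 0 for all i. Then there exists an injective function β : ℕ → F such that |β(i) − α(i)| < ε_i for all i ∈ ℕ and the set B = {β(i) : i ∈ ℕ} is an h-Sidon set. -/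
/-- Balls of positive radius for a nontrivial absolute value are not covered by finite sets. -/
theorem AbsoluteValue.IsNontrivial.exists_notMem_sub_lt {F : Type*} [Field F]
    {v : AbsoluteValue F ℝ} (hv : v.IsNontrivial) (a : F) {ε : ℝ} (hε : 0 < ε)
    {T : Set F} (hT : T.Finite) : ∃ y, y ∉ T ∧ v (y - a) < ε := by
  obtain ⟨x, hx0, hx1⟩ := hv.exists_abv_lt_one
  obtain ⟨N, hN⟩ := exists_pow_lt_of_lt_one hε hx1
  have hinj : Function.Injective fun k : ℕ => a + x ^ (k + N) := by
    intro k l hkl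
    have h1 : v x ^ (k + N) = v x ^ (l + N) := by
      rw [← map_pow, ← map_pow, add_left_cancel hkl]
    have h2 := pow_right_injective₀ (v.pos hx0) hx1.ne h1
    omega
  obtain ⟨_, ⟨k, rfl⟩, hk⟩ := (Set.infinite_range_of_injective hinj).exists_notMem_finite hT
  refine ⟨_, hk, ?_⟩
  simp only [add_sub_cancel_left, map_pow]
  exact (pow_le_pow_of_le_one (v.nonneg x) hx1.le (Nat.le_add_left N k)).trans_lt hN

/-- There are finitely many multisets of bounded cardinality with elements in a finite set. -/
theorem Multiset.finite_setOf_card_le_of_forall_mem {α : Type*} (h : ℕ) (S : Finset α) :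
    {s : Multiset α | Multiset.card s ≤ h ∧ ∀ x ∈ s, x ∈ S}.Finite := by
  classical
  refine (Set.finite_Iic (h • S.val)).subset ?_
  rintro s ⟨hs, hS⟩
  refine Multiset.le_iff_count.2 fun a => ?_
  by_cases ha : a ∈ s
  · rw [Multiset.count_nsmul, Multiset.count_eq_one_of_mem S.nodup (hS a ha), mul_one]
    exact (Multiset.count_le_card a s).trans hs
  · simp [Multiset.count_eq_zero_of_notMem ha]

/-- The elements some positive multiple of which, of order at most `h`, is a difference of
two sums of at most `h` elements of `S`. -/
def sidonObstruction {F : Type*} [Field F] (h : ℕ) (S : Finset F) : Set F :=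
  {x | ∃ c : ℕ, 0 < c ∧ c ≤ h ∧ ∃ s t : Multiset F,
    (Multiset.card s ≤ h ∧ ∀ y ∈ s, y ∈ S) ∧ (Multiset.card t ≤ h ∧ ∀ y ∈ t, y ∈ S) ∧
    c * x + s.sum = t.sum}

theorem finite_sidonObstruction {F : Type*} [Field F] [CharZero F] (h : ℕ) (S : Finset F) :
    (sidonObstruction h S).Finite := by
  have hM := Multiset.finite_setOf_card_le_of_forall_mem h S
  refine (((Set.finite_Iic h).prod (hM.prod hM)).image
    fun p : ℕ × Multiset F × Multiset F => (p.2.2.sum - p.2.1.sum) / (p.1 : F)).subset ?_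
  rintro x ⟨c, hc, hch, s, t, hs, ht, hx⟩
  refine ⟨(c, s, t), ⟨hch, hs, ht⟩, ?_⟩
  have : (c : F) ≠ 0 := Nat.cast_ne_zero.2 hc.ne'
  simp only
  rw [← hx]
  field_simp
  ring

/-- If each term avoids the obstruction from a finset containing the previous terms, then sums
of at most `h` terms determine the multiset of indices. -/
theorem multiset_eq_of_sum_map_eq {F : Type*} [Field F] {h : ℕ} {β : ℕ → F} {S : ℕ → Finset F}
    (hS : ∀ n, ∀ i < n, β i ∈ S n) (hβ : ∀ n, β n ∉ sidonObstruction h (S n)) (n : ℕ)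
    (s t : Multiset ℕ) (hs : ∀ i ∈ s, i < n) (ht : ∀ i ∈ t, i < n)
    (hsh : Multiset.card s ≤ h) (hth : Multiset.card t ≤ h)
    (hst : (s.map β).sum = (t.map β).sum) : s = t := by
  induction n generalizing s t with
  | zero =>
    rw [Multiset.eq_zero_of_forall_notMem fun i hi => Nat.not_lt_zero i (hs i hi),
      Multiset.eq_zero_of_forall_notMem fun i hi => Nat.not_lt_zero i (ht i hi)]
  | succ n ih =>
    have decomp : ∀ s : Multiset ℕ, (∀ i ∈ s, i < n + 1) → ∃ (a : ℕ) (s' : Multiset ℕ),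
        s = Multiset.replicate a n + s' ∧ ∀ i ∈ s', i < n := by
      intro s hs
      refine ⟨s.count n, s.filter (¬ n = ·), ?_, fun i hi => ?_⟩
      · rw [← Multiset.filter_eq, Multiset.filter_add_not]
      · have h1 := Multiset.mem_filter.1 hi
        have := hs i h1.1
        omega
    have not_coeff_lt : ∀ (a b : ℕ) (s t : Multiset ℕ), (∀ i ∈ s, i < n) → (∀ i ∈ t, i < n) →
        a + Multiset.card s ≤ h → b + Multiset.card t ≤ h →
        a * β n + (s.map β).sum = b * β n + (t.map β).sum → ¬ a < b := by
      intro a b s t hs ht hsh hth hst hab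
      refine hβ n ⟨b - a, by omega, by omega, t.map β, s.map β, ⟨?_, ?_⟩, ⟨?_, ?_⟩, ?_⟩
      · rw [Multiset.card_map]; omega
      · intro y hy
        obtain ⟨i, hi, rfl⟩ := Multiset.mem_map.1 hy
        exact hS n i (ht i hi)
      · rw [Multiset.card_map]; omega
      · intro y hy
        obtain ⟨i, hi, rfl⟩ := Multiset.mem_map.1 hy
        exact hS n i (hs i hi)
      · rw [Nat.cast_sub hab.le]
        linear_combination -hst
    obtain ⟨a, s, rfl, hs'⟩ := decomp s hs
    obtain ⟨b, t, rfl, ht'⟩ := decomp t ht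
    simp only [Multiset.card_add, Multiset.card_replicate] at hsh hth
    simp only [Multiset.map_add, Multiset.map_replicate, Multiset.sum_add,
      Multiset.sum_replicate, nsmul_eq_mul] at hst
    obtain rfl : a = b := le_antisymm
      (le_of_not_gt <| not_coeff_lt b a t s ht' hs' hth hsh hst.symm)
      (le_of_not_gt <| not_coeff_lt a b s t hs' ht' hsh hth hst)
    rw [ih s t hs' ht' (by omega) (by omega) (add_left_cancel hst)]

theorem exists_sidon_perturbation
    {F : Type*} [Field F] [CharZero F] (v : AbsoluteValue F ℝ)
    (hv : ∃ x : F, x ≠ 0 ∧ v x ≠ 1)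
    (h : ℕ) (hh : 0 < h) (α : ℕ → F) (hα : Function.Injective α)
    (ε : ℕ → ℝ) (hε : ∀ i, 0 < ε i) :
    ∃ β : ℕ → F, Function.Injective β ∧
      (∀ i, v (β i - α i) < ε i) ∧ IsSidonSet h (Set.range β) := by
  classical
  have hv' : v.IsNontrivial := hv
  choose g hg hgε using fun (n : ℕ) (S : Finset F) =>
    hv'.exists_notMem_sub_lt (α n) (hε n) (finite_sidonObstruction h S)
  let S : ℕ → Finset F := fun n => Nat.rec ∅ (fun n T => insert (g n T) T) n
  let β : ℕ → F := fun n => g n (S n)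
  have hS : ∀ n, ∀ i < n, β i ∈ S n := by
    intro n
    induction n with
    | zero => intro i hi; omega
    | succ n ih =>
      intro i hi
      change β i ∈ insert (β n) (S n)
      rcases Nat.lt_succ_iff_lt_or_eq.1 hi with hi | rfl
      · exact Finset.mem_insert_of_mem (ih i hi)
      · exact Finset.mem_insert_self _ _
  have key : ∀ s t : Multiset ℕ, Multiset.card s ≤ h → Multiset.card t ≤ h →
      (s.map β).sum = (t.map β).sum → s = t := by
    intro s t hsh hth hst
    refine multiset_eq_of_sum_map_eq hS (fun n => hg n (S n)) ((s + t).sum + 1) s t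
      (fun i hi => ?_) (fun i hi => ?_) hsh hth hst
    · exact Nat.lt_succ_of_le (Multiset.le_sum_of_mem (Multiset.mem_add.2 (Or.inl hi)))
    · exact Nat.lt_succ_of_le (Multiset.le_sum_of_mem (Multiset.mem_add.2 (Or.inr hi)))
  refine ⟨β, fun i j hij => ?_, fun i => hgε i (S i), fun s t hs ht hsh hth hst => ?_⟩
  · exact Multiset.singleton_inj.1 (key {i} {j} hh hh (by simpa using hij))
  · have : CanLift F ℕ β (· ∈ Set.range β) := ⟨fun _ hx => hx⟩
    lift s to Multiset ℕ using hs
    lift t to Multiset ℕ using ht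
    rw [Multiset.card_map] at hsh hth
    rw [key s t hsh.le hth.le hst]
end

section
/- Let F be a field of characteristic zero equipped with a nontrivial absolute value |·| (an absolute value is nontrivial if there exists x ≠ 0 with |x| ≠ 1). For every injective sequence a : ℕ → F there exists an injective sequence b : ℕ → F such that the set {b(i) : i ∈ ℕ} is a Sidon set (i.e., a 2-Sidon set) and lim_{i → ∞} |a(i) − b(i)| = 0. -/
theorem isSidonSet_two_iff {G : Type*} [AddCommGroup G] {A : Set G} :
    IsSidonSet 2 A ↔ ∀ p ∈ A, ∀ q ∈ A, ∀ r ∈ A, ∀ u ∈ A, p + q = r + u →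
      (p = r ∧ q = u) ∨ (p = u ∧ q = r) := by
  constructor
  · intro h p hp q hq r hr u hu heq
    have key : ({p, q} : Multiset G) = {r, u} :=
      h {p, q} {r, u} (by simp [hp, hq]) (by simp [hr, hu]) (by simp) (by simp)
        (by simpa using heq)
    rcases Multiset.cons_eq_cons.1 key with ⟨h1, h2⟩ | ⟨-, cs, h1, h2⟩
    · exact Or.inl ⟨h1, by simpa using h2⟩
    · have hcs : cs = 0 := by
        have := congrArg Multiset.card h1
        simpa using this
      subst hcs
      refine Or.inr ⟨?_, ?_⟩
      · simpa using h2.symm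
      · simpa using h1
  · intro h s t hs ht hsc htc heq
    obtain ⟨p, q, rfl⟩ := Multiset.card_eq_two.1 hsc
    obtain ⟨r, u, rfl⟩ := Multiset.card_eq_two.1 htc
    rcases h p (hs p (by simp)) q (hs q (by simp)) r (ht r (by simp)) u (ht u (by simp))
      (by simpa using heq) with ⟨rfl, rfl⟩ | ⟨rfl, rfl⟩
    · rfl
    · exact Multiset.pair_comm _ _

theorem IsSidonSet.insert_two {G : Type*} [AddCommGroup G] {A : Set G} (hA : IsSidonSet 2 A)
    {x : G} (h₁ : ∀ p ∈ A, ∀ q ∈ A, ∀ r ∈ A, x + p ≠ q + r)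
    (h₂ : ∀ q ∈ A, ∀ r ∈ A, x + x ≠ q + r) : IsSidonSet 2 (insert x A) := by
  have hx : x ∉ A := fun hx => h₂ x hx x hx rfl
  rw [isSidonSet_two_iff] at hA ⊢
  rintro p (rfl | hp) q (rfl | hq) r (rfl | hr) u (rfl | hu) heq <;> grind

theorem isSidonSet_two_range {G : Type*} [AddCommGroup G] {b : ℕ → G}
    (h₁ : ∀ n, ∀ i < n, ∀ j < n, ∀ k < n, b n + b i ≠ b j + b k)
    (h₂ : ∀ n, ∀ j < n, ∀ k < n, b n + b n ≠ b j + b k) : IsSidonSet 2 (Set.range b) := by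
  have hfin : ∀ n, IsSidonSet 2 (b '' Set.Iio n) := by
    intro n
    induction n with
    | zero => rw [isSidonSet_two_iff]; simp
    | succ n ih =>
      rw [← Order.succ_eq_add_one, Order.Iio_succ_eq_insert, Set.image_insert_eq]
      refine ih.insert_two ?_ ?_
      · rintro _ ⟨i, hi, rfl⟩ _ ⟨j, hj, rfl⟩ _ ⟨k, hk, rfl⟩
        exact h₁ n i hi j hj k hk
      · rintro _ ⟨j, hj, rfl⟩ _ ⟨k, hk, rfl⟩
        exact h₂ n j hj k hk
  rw [isSidonSet_two_iff]
  rintro _ ⟨i, rfl⟩ _ ⟨j, rfl⟩ _ ⟨k, rfl⟩ _ ⟨l, rfl⟩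
  have hmem : ∀ m ≤ i + j + k + l, b m ∈ b '' Set.Iio (i + j + k + l + 1) :=
    fun m hm => ⟨m, Nat.lt_succ_of_le hm, rfl⟩
  exact isSidonSet_two_iff.1 (hfin _) _ (hmem i (by omega)) _ (hmem j (by omega))
    _ (hmem k (by omega)) _ (hmem l (by omega))

theorem AbsoluteValue.IsNontrivial.infinite_setOf_sub_lt {F : Type*} [Field F]
    {v : AbsoluteValue F ℝ} (hv : v.IsNontrivial) (x : F) {ε : ℝ} (hε : 0 < ε) :
    {y : F | v (x - y) < ε}.Infinite := by
  obtain ⟨z, hz0, hz1⟩ := hv.exists_abv_lt_one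
  have hz : 0 < v z := v.pos hz0
  obtain ⟨N, hN⟩ := exists_pow_lt_of_lt_one hε hz1
  refine Set.infinite_of_injective_forall_mem (f := fun m : ℕ => x - z ^ (N + m)) ?_ ?_
  · intro m m' h
    have := congrArg v (sub_right_injective h)
    simp only [map_pow] at this
    have := pow_right_injective₀ hz hz1.ne this
    omega
  · intro m
    simp only [Set.mem_ofPred_eq, sub_sub_cancel, map_pow]
    exact (pow_le_pow_of_le_one hz.le hz1.le (Nat.le_add_right N m)).trans_lt hN

/-- The sequence whose `n`-th term is `f n` applied to the finset of all earlier terms. -/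
noncomputable def greedySequence {α : Type*} (f : ℕ → Finset α → α) (n : ℕ) : α :=
  open Classical in f n (Finset.univ.image fun i : Fin n => greedySequence f i)
termination_by n
decreasing_by exact i.2

theorem exists_seq_forall_notMem_finset {α : Type*} {U : ℕ → Set α} (hU : ∀ n, (U n).Infinite)
    (T : Finset α → Finset α) :
    ∃ b : ℕ → α, ∀ n, b n ∈ U n ∧ ∃ S : Finset α, (∀ i < n, b i ∈ S) ∧ b n ∉ T S := by
  classical
  choose f hfU hfT using fun n (S : Finset α) => (hU n).exists_notMem_finset (T S)
  refine ⟨greedySequence f, fun n => ?_⟩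
  rw [greedySequence]
  refine ⟨hfU _ _, _, fun i hi => ?_, hfT _ _⟩
  exact Finset.mem_image.2 ⟨⟨i, hi⟩, Finset.mem_univ _, rfl⟩

theorem exists_sidon_set_close_to_sequence
    {F : Type*} [Field F] [CharZero F] (v : AbsoluteValue F ℝ)
    (hv : ∃ x : F, x ≠ 0 ∧ v x ≠ 1)
    (a : ℕ → F) (ha : Function.Injective a) :
    ∃ b : ℕ → F, Function.Injective b ∧ IsSidonSet 2 (Set.range b) ∧
      Filter.Tendsto (fun i => v (a i - b i)) Filter.atTop (nhds 0) := by
  classical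
  obtain ⟨x₀, hx₀, hx₁⟩ := hv
  have hnt : v.IsNontrivial := ⟨x₀, hx₀, hx₁⟩
  let T : Finset F → Finset F := fun S =>
    (S ×ˢ S ×ˢ S).image (fun p => p.2.1 + p.2.2 - p.1) ∪
      (S ×ˢ S).image (fun p => (p.1 + p.2) / 2)
  obtain ⟨b, hb⟩ := exists_seq_forall_notMem_finset
    (fun n : ℕ => hnt.infinite_setOf_sub_lt (a n) (Nat.one_div_pos_of_nat (α := ℝ) (n := n))) T
  have h₁ : ∀ n, ∀ i < n, ∀ j < n, ∀ k < n, b n + b i ≠ b j + b k := by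
    intro n i hi j hj k hk h
    obtain ⟨-, S, hS, hT⟩ := hb n
    refine hT (Finset.mem_union_left _ (Finset.mem_image.2 ⟨(b i, b j, b k), ?_, ?_⟩))
    · simp [hS i hi, hS j hj, hS k hk]
    · exact (eq_sub_of_add_eq h).symm
  have h₂ : ∀ n, ∀ j < n, ∀ k < n, b n + b n ≠ b j + b k := by
    intro n j hj k hk h
    obtain ⟨-, S, hS, hT⟩ := hb n
    refine hT (Finset.mem_union_right _ (Finset.mem_image.2 ⟨(b j, b k), ?_, ?_⟩))
    · simp [hS j hj, hS k hk]
    · simp only [← h, add_self_div_two]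
  refine ⟨b, Function.Injective.of_lt_imp_ne fun i n hi h => ?_, isSidonSet_two_range h₁ h₂, ?_⟩
  · exact h₂ n i hi i hi (by rw [h])
  · exact squeeze_zero (fun _ => v.nonneg _) (fun n => (hb n).1.le)
      tendsto_one_div_add_atTop_nhds_zero_nat
end

section
/- Let h be an integer with h ≥ 2. Then the set {h^i : i ∈ ℕ₀} of nonnegative integer powers of h is an h-Sidon set in the additive group of integers ℤ. -/
/-- A sum of powers of `h` is congruent modulo `h` to the number of zero exponents. -/
theorem sum_map_pow_modEq_count_zero (h : ℕ) (S : Multiset ℕ) :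
    (S.map (h ^ ·)).sum ≡ S.count 0 [MOD h] := by
  induction S using Multiset.induction_on with
  | empty => simp [Nat.ModEq]
  | cons a S ih =>
    rw [Multiset.map_cons, Multiset.sum_cons]
    rcases Nat.eq_zero_or_pos a with rfl | ha
    · rw [Multiset.count_cons_self, pow_zero, add_comm]
      exact ih.add_right 1
    · rw [Multiset.count_cons_of_ne ha.ne]
      have h0 : h ^ a ≡ 0 [MOD h] := (Nat.modEq_zero_iff_dvd).2 (dvd_pow_self h ha.ne')
      simpa using h0.add ih

/-- A multiset of natural numbers not containing `0` is a shift by one. -/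
theorem Multiset.exists_eq_map_succ_of_zero_notMem {S : Multiset ℕ} (hS : 0 ∉ S) :
    ∃ S' : Multiset ℕ, S = S'.map Nat.succ := by
  refine ⟨S.map Nat.pred, ?_⟩
  rw [Multiset.map_map]
  conv_lhs => rw [← Multiset.map_id S]
  refine Multiset.map_congr rfl fun x hx => ?_
  have : x ≠ 0 := fun h => hS (h ▸ hx)
  exact (Nat.succ_pred this).symm

/-- Two sums of equally many, at most `h`, powers of `h` differ if `1` occurs in exactly one. -/
theorem sum_map_pow_ne_of_zero_mem {h : ℕ} (hh : 2 ≤ h) {S T : Multiset ℕ} (hS : 0 ∈ S)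
    (hT : 0 ∉ T) (hcard : S.card = T.card) (hle : S.card ≤ h) :
    (S.map (h ^ ·)).sum ≠ (T.map (h ^ ·)).sum := by
  intro heq
  have hmod : S.count 0 ≡ 0 [MOD h] := by
    have h1 := sum_map_pow_modEq_count_zero h T
    rw [Multiset.count_eq_zero.2 hT, ← heq] at h1
    exact (sum_map_pow_modEq_count_zero h S).symm.trans h1
  have hcount : h ≤ S.count 0 :=
    Nat.le_of_dvd (Multiset.count_pos.2 hS) ((Nat.modEq_zero_iff_dvd).1 hmod)
  have hSh : S.card = h := le_antisymm hle (hcount.trans (Multiset.count_le_card 0 S))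
  have hrep : S = Multiset.replicate h 0 :=
    (Multiset.eq_of_le_of_card_le (Multiset.le_count_iff_replicate_le.1 hcount)
      (by simp [hSh])).symm
  have hsum : (S.map (h ^ ·)).sum = h := by simp [hrep]
  have hge : (T.map (h ^ ·)).card • h ≤ (T.map (h ^ ·)).sum := by
    refine Multiset.card_nsmul_le_sum fun x hx => ?_
    obtain ⟨i, hi, rfl⟩ := Multiset.mem_map.1 hx
    exact Nat.le_self_pow (fun h0 => hT (h0 ▸ hi)) h
  rw [Multiset.card_map, ← hcard, hSh, ← heq, hsum, smul_eq_mul] at hge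
  nlinarith

/-- Equally many, at most `h`, powers of `h` are determined by their sum. -/
theorem eq_of_sum_map_pow_eq {h : ℕ} (hh : 2 ≤ h) (S T : Multiset ℕ)
    (hcard : S.card = T.card) (hle : S.card ≤ h)
    (heq : (S.map (h ^ ·)).sum = (T.map (h ^ ·)).sum) : S = T := by
  induction hn : (S.map Nat.succ).sum using Nat.strong_induction_on generalizing S T with
  | _ n ih =>
    by_cases hS : 0 ∈ S <;> by_cases hT : 0 ∈ T
    · obtain ⟨S', rfl⟩ := Multiset.exists_cons_of_mem hS
      obtain ⟨T', rfl⟩ := Multiset.exists_cons_of_mem hT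
      simp only [Multiset.card_cons, Multiset.map_cons, Multiset.sum_cons] at hcard hle heq hn
      rw [ih _ (by omega) S' T' (by omega) (by omega) (by omega) rfl]
    · exact absurd heq (sum_map_pow_ne_of_zero_mem hh hS hT hcard hle)
    · exact absurd heq.symm (sum_map_pow_ne_of_zero_mem hh hT hS hcard.symm (hcard ▸ hle))
    · obtain ⟨S', rfl⟩ := Multiset.exists_eq_map_succ_of_zero_notMem hS
      obtain ⟨T', rfl⟩ := Multiset.exists_eq_map_succ_of_zero_notMem hT
      simp only [Multiset.card_map] at hcard hle
      rcases Nat.eq_zero_or_pos S'.card with h0 | hpos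
      · rw [Multiset.card_eq_zero.1 h0, Multiset.card_eq_zero.1 (hcard.symm.trans h0)]
      · simp only [Multiset.map_map, Function.comp_def, Nat.succ_eq_add_one, pow_succ,
          Multiset.sum_map_mul_right] at heq
        have hlt : (S'.map Nat.succ).sum < n := by
          simp only [← hn, Multiset.map_map, Function.comp_def, Nat.succ_eq_add_one,
            Multiset.sum_map_add, Multiset.map_const', Multiset.sum_replicate, smul_eq_mul]
          omega
        rw [ih _ hlt S' T' hcard hle (Nat.eq_of_mul_eq_mul_right (by omega) heq) rfl]

theorem powers_are_h_sidon (h : ℕ) (hh : 2 ≤ h) :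
    IsSidonSet h {n : ℤ | ∃ i : ℕ, n = (h : ℤ) ^ i} := by
  have lift_exponents : ∀ s : Multiset ℤ, (∀ x ∈ s, x ∈ {n : ℤ | ∃ i : ℕ, n = (h : ℤ) ^ i}) →
      ∃ S : Multiset ℕ, s = S.map fun i => (h : ℤ) ^ i := by
    intro s
    induction s using Multiset.induction_on with
    | empty => exact fun _ => ⟨0, rfl⟩
    | cons a s ih =>
      intro hs
      obtain ⟨i, rfl⟩ := hs a (Multiset.mem_cons_self a s)
      obtain ⟨S, rfl⟩ := ih fun x hx => hs x (Multiset.mem_cons_of_mem hx)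
      exact ⟨i ::ₘ S, by simp⟩
  have sum_cast : ∀ S : Multiset ℕ,
      (S.map fun i => (h : ℤ) ^ i).sum = ((S.map (h ^ ·)).sum : ℕ) := by
    intro S
    simp
  intro s t hs ht hsc htc heq
  obtain ⟨S, rfl⟩ := lift_exponents s hs
  obtain ⟨T, rfl⟩ := lift_exponents t ht
  rw [Multiset.card_map] at hsc htc
  rw [sum_cast, sum_cast] at heq
  rw [eq_of_sum_map_pow_eq hh S T (hsc.trans htc.symm) hsc.le (by exact_mod_cast heq)]
end

section
/- Let h be an integer with h ≥ 2. Then the set {h^i : i ∈ ℕ₀} of nonnegative integer powers of h is not an (h+1)-Sidon set in the additive group of integers ℤ: for all nonnegative integers a < b, the identity h·h^a + h^{b+1} = h^{a+1} + h·h^b exhibits an element of the (h+1)-fold sumset with two essentially distinct representations as a sum of h+1 elements of the set. -/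
theorem powers_not_h_succ_sidon (h : ℕ) (hh : 2 ≤ h) :
    (∀ a b : ℕ, a < b →
      h • ((h : ℤ) ^ a) + (h : ℤ) ^ (b + 1) = (h : ℤ) ^ (a + 1) + h • ((h : ℤ) ^ b)) ∧
    ¬ IsSidonSet (h + 1) {n : ℤ | ∃ i : ℕ, n = (h : ℤ) ^ i} := by
  refine ⟨fun a b _ => by simp only [nsmul_eq_mul]; ring, fun hS => ?_⟩
  have key := hS (Multiset.replicate h 1 + {(h : ℤ) ^ 2}) (Multiset.replicate (h + 1) (h : ℤ))
    (fun x hx => ?_) (fun x hx => ⟨1, by simp [Multiset.eq_of_mem_replicate hx]⟩)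
    (by simp) (by simp) (by simp; ring)
  · have h_one : (1 : ℤ) ∈ Multiset.replicate (h + 1) (h : ℤ) := by
      rw [← key]
      exact Multiset.mem_add.2 (Or.inl (Multiset.mem_replicate.2 ⟨by omega, rfl⟩))
    have := Multiset.eq_of_mem_replicate h_one
    omega
  · rcases Multiset.mem_add.1 hx with hx | hx
    · exact ⟨0, by simp [Multiset.eq_of_mem_replicate hx]⟩
    · exact ⟨2, Multiset.mem_singleton.1 hx⟩
end
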